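/- Let ρ = p^ℕ be a Bernoulli product measure on D^ℕ with probability weight vector p = (p_1,…,p_m), set s = ∑_{i=1}^m p_i², and let μ_{γ,λ} = ρ ∘ Π_{γ,λ}^{-1}, ν_λ = ρ ∘ Π_λ^{-1}. Assume: (i) there is an open interval I ⊂ (1/m,1) such that for every closed interval I′ ⊂ I one has ∫_{I′} ‖dν_λ/dx‖_{L²}² dλ < ∞ (with ‖dν_λ/dx‖_{L²} = ∞ when ν_λ has no L² density); (ii) there is an open interval J ⊂ (1/m,1) such that no f ∈ 𝓑 has a root of multiplicity ≥ 2 in J; (iii) there is an open set R ⊂ ℝ² such that for every (γ,λ) ∈ R there is no f ∈ 𝓑 having both γ and λ as roots of multiplicity ≥ 2. Let S = (R ∩ (I×I) ∩ Γ(s,1)) ∪ ((J×I) ∩ Γ(s,1)). Then for Lebesgue-almost every (γ,λ) ∈ S, μ_{γ,λ} is absolutely continuous with respect to Lebesgue measure on ℝ² with a density in L²(ℝ²). -/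

import Mathlib

open MeasureTheory Filter Set
open scoped ENNReal Topology

noncomputable section

/-- `Γ(a,b) = {(γ,λ) : 0 < γ < λ < 1, 1/m < λ, a < γλ < b}`. -/
def Gamma (m : ℕ) (a b : ℝ) : Set (ℝ × ℝ) :=
  {p | 0 < p.1 ∧ p.1 < p.2 ∧ p.2 < 1 ∧ 1 / (m : ℝ) < p.2 ∧ a < p.1 * p.2 ∧ p.1 * p.2 < b}

/-- Evaluation of the power series with coefficient sequence `c` at `x`. -/
def Beval (c : ℕ → ℝ) (x : ℝ) : ℝ := ∑' n, c n * x ^ n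

/-- Membership in `𝓑̃`: all coefficients lie in `D − D`. -/
def memBtilde (m : ℕ) (d : Fin m → ℝ) (c : ℕ → ℝ) : Prop :=
  ∀ n, ∃ i j, c n = d i - d j

/-- Membership in `𝓑`: all coefficients lie in `D − D` and the constant term is nonzero. -/
def memB (m : ℕ) (d : Fin m → ℝ) (c : ℕ → ℝ) : Prop :=
  memBtilde m d c ∧ c 0 ≠ 0

/-- `α` is a root of multiplicity at least 2 of the power series with coefficients `c`. -/
def HasDoubleRootAt (c : ℕ → ℝ) (α : ℝ) : Prop :=
  Beval c α = 0 ∧ deriv (Beval c) α = 0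

/-- `ρ` is the Bernoulli product measure with weights `p`. -/
def IsBernoulliWith {α : Type*} [MeasurableSpace α] (p : α → ℝ≥0∞)
    (ρ : Measure (ℕ → α)) : Prop :=
  IsProbabilityMeasure ρ ∧
    ∀ (n : ℕ) (w : Fin n → α), ρ {ω | ∀ i : Fin n, ω i.1 = w i} = ∏ i, p (w i)

/-- `Π_λ(ω) = ∑ₙ d(ωₙ) λⁿ`. -/
def PiOne (m : ℕ) (d : Fin m → ℝ) (l : ℝ) (ω : ℕ → Fin m) : ℝ := ∑' n, d (ω n) * l ^ n

/-- `Π_{γ,λ}(ω) = ∑ₙ d(ωₙ)(γⁿ, λⁿ)`. -/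
def PiTwo (m : ℕ) (d : Fin m → ℝ) (g l : ℝ) (ω : ℕ → Fin m) : ℝ × ℝ :=
  (PiOne m d g ω, PiOne m d l ω)

open Classical in
/-- `‖dν/dx‖₂²` — the squared `L²` norm of the density of `ν` with respect to Lebesgue
measure, with the convention that it is `∞` when `ν` is not absolutely continuous (and also
when the density is not in `L²`). -/
def densityL2sq (ν : Measure ℝ) : ℝ≥0∞ :=
  if ν ≪ (volume : Measure ℝ) then ∫⁻ x, (ν.rnDeriv volume x) ^ 2 else ⊤

/-- criterion for absolute continuity with `L²` density. -/
lemma ac_criterion (μ : Measure (ℝ × ℝ)) [IsFiniteMeasure μ] (r : ℕ → ℝ) (hr : ∀ j, 0 < r j)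
    (hr0 : Tendsto r atTop (𝓝 0))
    (h : liminf (fun j => ∫⁻ x, μ (Metric.closedBall x (r j)) /
      volume (Metric.closedBall x (r j)) ∂μ) atTop < ⊤) :
    μ ≪ volume ∧ ∫⁻ x, (μ.rnDeriv volume x) ^ 2 < ⊤ := by
  have hr' : Tendsto r atTop (𝓝[>] 0) :=
    tendsto_nhdsWithin_iff.2 ⟨hr0, Eventually.of_forall hr⟩
  have hmeas : ∀ j, Measurable (fun x : ℝ × ℝ => μ (Metric.closedBall x (r j)) /
      volume (Metric.closedBall x (r j))) := by
    intro j
    have hc : IsClosed {z : (ℝ × ℝ) × (ℝ × ℝ) | dist z.2 z.1 ≤ r j} :=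
      isClosed_le (by fun_prop) (by fun_prop)
    exact (measurable_measure_prodMk_left (ν := μ) hc.measurableSet).div
      (measurable_measure_prodMk_left (ν := (volume : Measure (ℝ × ℝ))) hc.measurableSet)
  have hF := (lintegral_liminf_le (μ := μ) (u := atTop) hmeas).trans_lt h
  have hlt := ae_lt_top (Measurable.liminf hmeas) hF.ne
  have hac : μ ≪ volume := by
    have hg : ∀ᵐ x ∂μ, (volume : Measure (ℝ × ℝ)).rnDeriv μ x ≠ 0 := by
      filter_upwards [hlt, Besicovitch.ae_tendsto_rnDeriv (volume : Measure (ℝ × ℝ)) μ] with x h1 h2 h3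
      have h4 := (h2.comp hr')
      have h5 := ( (continuous_inv (G := ℝ≥0∞)).tendsto _).comp h4
      rw [h3, ENNReal.inv_zero] at h5
      have h6 : (fun j => μ (Metric.closedBall x (r j)) /
          volume (Metric.closedBall x (r j))) = (fun y => y⁻¹) ∘ (fun r => volume (Metric.closedBall x r) /
           μ (Metric.closedBall x r)) ∘ r := by
        funext j
        simp only [Function.comp]
        rw [ENNReal.inv_div (Or.inl (measure_ne_top _ _))]
        right
        exact (Metric.measure_closedBall_pos _ _ (hr j)).ne'
      rw [h6] at h1
      have h7 := h5.liminf_eq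
      exact absurd h7 h1.ne
    intro A hA
    obtain ⟨B, hAB, hB, hB0⟩ := exists_measurable_superset_of_null hA
    have h1 : μ.withDensity ((volume : Measure (ℝ × ℝ)).rnDeriv μ) B = 0 :=
      le_antisymm ((Measure.withDensity_rnDeriv_le _ _ B).trans hB0.le) zero_le
    rw [withDensity_apply _ hB, lintegral_eq_zero_iff (Measure.measurable_rnDeriv _ _)] at h1
    have h2 := (ae_restrict_iff' hB).1 h1
    have h3 : ∀ᵐ x ∂μ, x ∉ B := by
      filter_upwards [h2, hg] with x a b c
      exact b (a c)
    exact measure_mono_null hAB (by simpa using measure_eq_zero_iff_ae_notMem.2 h3)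
  refine ⟨hac, ?_⟩
  have h1 : ∫⁻ x, (μ.rnDeriv volume x) ^ 2 = ∫⁻ x, μ.rnDeriv volume x ∂μ := by
    rw [← lintegral_rnDeriv_mul hac (Measure.measurable_rnDeriv _ _).aemeasurable]
    simp only [sq]
  rw [h1]
  refine lt_of_le_of_lt (le_of_eq ?_) hF
  refine lintegral_congr_ae ?_
  filter_upwards [hac.ae_le (Besicovitch.ae_tendsto_rnDeriv μ (volume : Measure (ℝ × ℝ)))] with x hx
  exact ((hx.comp hr').liminf_eq).symm

lemma mul_le_sq_add_sq_ennreal (a b : ℝ≥0∞) : a * b ≤ a ^ 2 + b ^ 2 := by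
  rcases le_total a b with h | h
  · calc a * b ≤ b * b := by gcongr
      _ = b ^ 2 := (sq b).symm
      _ ≤ _ := le_add_self
  · calc a * b ≤ a * a := by gcongr
      _ = a ^ 2 := (sq a).symm
      _ ≤ _ := le_self_add

/-- pair correlation estimate by the `L²` norm. -/
lemma prod_le_densityL2sq (ν : Measure ℝ) [IsFiniteMeasure ν] (v : ℝ) (hv : 0 < v) :
    (ν.prod ν) {z | |z.1 - z.2| ≤ v} ≤ ENNReal.ofReal (4 * v) * densityL2sq ν := by
  unfold densityL2sq
  split_ifs with hac
  swap
  · rw [ENNReal.mul_top]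
    · exact le_top
    · simpa using hv
  have hA : MeasurableSet {z : ℝ × ℝ | |z.1 - z.2| ≤ v} :=
    (isClosed_le (by fun_prop) (by fun_prop)).measurableSet
  set A := {z : ℝ × ℝ | |z.1 - z.2| ≤ v} with hAdef
  set h := ν.rnDeriv volume with hh
  have hm : Measurable h := Measure.measurable_rnDeriv _ _
  have hind : Measurable (A.indicator (fun _ => (1 : ℝ≥0∞))) := measurable_const.indicator hA
  have e1 : (ν.prod ν) A = ∫⁻ x, h x * ∫⁻ y, h y * A.indicator (fun _ => 1) (x, y) := by
    rw [← lintegral_indicator_one hA]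
    have : (A.indicator 1 : ℝ × ℝ → ℝ≥0∞) = A.indicator (fun _ => 1) := rfl
    rw [this, lintegral_prod _ hind.aemeasurable]
    rw [← lintegral_rnDeriv_mul hac]
    · congr 1; ext x; congr 1
      rw [← lintegral_rnDeriv_mul hac]
      exact (hind.comp measurable_prodMk_left).aemeasurable
    · exact (Measurable.lintegral_prod_right' (f := A.indicator (fun _ => (1 : ℝ≥0∞))) hind).aemeasurable
  have hvol1 : ∀ x, ∫⁻ y, A.indicator (fun _ => (1:ℝ≥0∞)) (x, y) = ENNReal.ofReal (2 * v) := by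
    intro x
    have : (fun y => A.indicator (fun _ => (1:ℝ≥0∞)) (x, y)) = (Metric.closedBall x v).indicator 1 := by
      funext y
      simp only [indicator, hAdef, mem_ofPred_eq, Metric.mem_closedBall, Real.dist_eq, abs_sub_comm, Pi.one_apply]
    rw [this, lintegral_indicator_one measurableSet_closedBall, Real.volume_closedBall]
  have hvol2 : ∀ y, ∫⁻ x, A.indicator (fun _ => (1:ℝ≥0∞)) (x, y) = ENNReal.ofReal (2 * v) := by
    intro y
    have : (fun x => A.indicator (fun _ => (1:ℝ≥0∞)) (x, y)) = (Metric.closedBall y v).indicator 1 := by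
      funext y
      simp only [indicator, hAdef, mem_ofPred_eq, Metric.mem_closedBall, Real.dist_eq, Pi.one_apply]
    rw [this, lintegral_indicator_one measurableSet_closedBall, Real.volume_closedBall]
  have m1 : Measurable (fun z : ℝ × ℝ => h z.1 ^ 2 * A.indicator (fun _ => (1:ℝ≥0∞)) z) := by fun_prop
  have m2 : Measurable (fun z : ℝ × ℝ => h z.2 ^ 2 * A.indicator (fun _ => (1:ℝ≥0∞)) z) := by fun_prop
  calc (ν.prod ν) A = ∫⁻ x, h x * ∫⁻ y, h y * A.indicator (fun _ => 1) (x, y) := e1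
    _ = ∫⁻ x, ∫⁻ y, h x * (h y * A.indicator (fun _ => 1) (x, y)) := by
        congr 1; ext x
        rw [lintegral_const_mul]
        exact hm.mul (hind.comp measurable_prodMk_left)
    _ ≤ ∫⁻ x, ∫⁻ y, (h x ^ 2 * A.indicator (fun _ => 1) (x, y) + h y ^ 2 * A.indicator (fun _ => 1) (x, y)) := by
        refine lintegral_mono fun x => lintegral_mono fun y => ?_
        rw [← mul_assoc, ← add_mul]
        gcongr
        exact mul_le_sq_add_sq_ennreal _ _
    _ = ∫⁻ x, ((∫⁻ y, h x ^ 2 * A.indicator (fun _ => 1) (x, y)) + ∫⁻ y, h y ^ 2 * A.indicator (fun _ => 1) (x, y)) := by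
        congr 1; ext x
        rw [lintegral_add_left]
        exact m1.comp measurable_prodMk_left
    _ = (∫⁻ x, ∫⁻ y, h x ^ 2 * A.indicator (fun _ => 1) (x, y)) + ∫⁻ x, ∫⁻ y, h y ^ 2 * A.indicator (fun _ => 1) (x, y) := by
        rw [lintegral_add_left]
        exact m1.lintegral_prod_right'
    _ = (∫⁻ x, h x ^ 2 * ENNReal.ofReal (2 * v)) + ∫⁻ y, h y ^ 2 * ENNReal.ofReal (2 * v) := by
        congr 1
        · congr 1; ext x
          rw [lintegral_const_mul _ (by exact hind.comp measurable_prodMk_left), hvol1]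
        · rw [lintegral_lintegral_swap m2.aemeasurable]
          congr 1; ext x
          rw [lintegral_const_mul _ (by exact hind.comp measurable_prodMk_right), hvol2]
    _ = ENNReal.ofReal (4 * v) * ∫⁻ x, h x ^ 2 := by
        rw [lintegral_mul_const _ (hm.pow_const 2), mul_comm, ← add_mul, ← ENNReal.ofReal_add (by positivity) (by positivity)]
        ring_nf

lemma transversal_volume (f f' : ℝ → ℝ) (a b δ u : ℝ) (hab : a ≤ b) (hδ : 0 < δ) (hu : 0 < u)
    (hf : ∀ x ∈ Icc a b, HasDerivAt f (f' x) x)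
    (h : (∀ x ∈ Icc a b, δ ≤ |f x|) ∨ (∀ x ∈ Icc a b, δ ≤ |f' x|)) :
    volume {x | x ∈ Icc a b ∧ |f x| ≤ u} ≤ ENNReal.ofReal ((b - a + 2) / δ * u) := by
  rcases h with h | h
  · rcases lt_or_ge u δ with hlt | hge
    · have : {x | x ∈ Icc a b ∧ |f x| ≤ u} = ∅ := by
        ext x; simp only [mem_ofPred_eq, mem_empty_iff_false, iff_false, not_and]
        intro hx hxu
        linarith [h x hx]
      rw [this]; simp
    · calc _ ≤ volume (Icc a b) := measure_mono fun x hx => hx.1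
        _ = ENNReal.ofReal (b - a) := Real.volume_Icc
        _ ≤ _ := by
          apply ENNReal.ofReal_le_ofReal
          rw [div_mul_eq_mul_div, le_div_iff₀ hδ]
          nlinarith
  · refine (Real.volume_le_diam _).trans (Metric.ediam_le ?_)
    have key : ∀ x y, x ∈ Icc a b → y ∈ Icc a b → |f x| ≤ u → |f y| ≤ u → x < y →
        y - x ≤ (b - a + 2) / δ * u := by
      intro x y hx hy hfx hfy hxy
      have hsub : Icc x y ⊆ Icc a b := Icc_subset_Icc hx.1 hy.2
      obtain ⟨c, hc, hc'⟩ := exists_hasDerivAt_eq_slope f f' hxy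
        (fun z hz => (hf z (hsub hz)).continuousAt.continuousWithinAt)
        (fun z hz => hf z (hsub (Ioo_subset_Icc_self hz)))
      have h1 := h c (hsub (Ioo_subset_Icc_self hc))
      rw [hc', abs_div, abs_of_pos (sub_pos.2 hxy), le_div_iff₀ (sub_pos.2 hxy)] at h1
      have h2 : |f y - f x| ≤ 2 * u := by
        rw [abs_le] at *; constructor <;> linarith [hfx.1, hfx.2, hfy.1, hfy.2]
      rw [div_mul_eq_mul_div, le_div_iff₀ hδ]
      nlinarith
    rintro x ⟨hx, hfx⟩ y ⟨hy, hfy⟩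
    rw [edist_dist, Real.dist_eq]
    apply ENNReal.ofReal_le_ofReal
    rcases lt_trichotomy x y with hxy | hxy | hxy
    · rw [abs_sub_comm, abs_of_pos (sub_pos.2 hxy)]; exact key x y hx hy hfx hfy hxy
    · subst hxy
      have : 0 ≤ b - a := by linarith
      simp; positivity
    · rw [abs_of_pos (sub_pos.2 hxy)]; exact key y x hy hx hfy hfx hxy

def shiftSeq {α : Type*} (ω : ℕ → α) : ℕ → α := fun n => ω (n + 1)

lemma measurable_shiftSeq {α : Type*} [MeasurableSpace α] :
    Measurable (shiftSeq : (ℕ → α) → (ℕ → α)) :=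
  measurable_pi_lambda _ fun n => measurable_pi_apply (n + 1)

def cylSets (m : ℕ) : Set (Set (ℕ → Fin m)) :=
  {S | ∃ (n : ℕ) (w : Fin n → Fin m), S = {ω | ∀ i : Fin n, ω i.1 = w i}}

lemma measurableSet_cyl (m n : ℕ) (w : Fin n → Fin m) :
    MeasurableSet {ω : ℕ → Fin m | ∀ i : Fin n, ω i.1 = w i} := by
  have : {ω : ℕ → Fin m | ∀ i : Fin n, ω i.1 = w i} =
      ⋂ i : Fin n, (fun ω : ℕ → Fin m => ω i.1) ⁻¹' {w i} := by
    ext ω; simp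
  rw [this]
  exact MeasurableSet.iInter fun i => measurable_pi_apply i.1 (measurableSet_singleton _)

lemma isPiSystem_cylSets (m : ℕ) : IsPiSystem (cylSets m) := by
  rintro _ ⟨n, w, rfl⟩ _ ⟨k, v, rfl⟩ ⟨ω₀, h1, h2⟩
  refine ⟨max n k, fun i => ω₀ i.1, ?_⟩
  ext ω
  constructor
  · rintro ⟨h3, h4⟩ i
    rcases lt_max_iff.1 i.2 with hi | hi
    · exact (h3 ⟨i.1, hi⟩).trans (h1 ⟨i.1, hi⟩).symm
    · exact (h4 ⟨i.1, hi⟩).trans (h2 ⟨i.1, hi⟩).symm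
  · intro h
    refine ⟨fun i => ?_, fun i => ?_⟩
    · exact (h ⟨i.1, lt_max_of_lt_left i.2⟩).trans (h1 i)
    · exact (h ⟨i.1, lt_max_of_lt_right i.2⟩).trans (h2 i)

lemma generateFrom_cylSets (m : ℕ) :
    (inferInstance : MeasurableSpace (ℕ → Fin m)) = MeasurableSpace.generateFrom (cylSets m) := by
  apply le_antisymm
  · refine iSup_le fun n => ?_
    rw [← measurable_iff_comap_le]
    refine @measurable_to_countable' _ _ _ _ (MeasurableSpace.generateFrom (cylSets m)) _ fun a => ?_
    have : (fun ω : ℕ → Fin m => ω n) ⁻¹' {a} =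
        ⋃ w : {w : Fin (n + 1) → Fin m // w (Fin.last n) = a},
          {ω | ∀ i : Fin (n + 1), ω i.1 = w.1 i} := by
      ext ω
      simp only [mem_preimage, mem_singleton_iff, mem_iUnion]
      constructor
      · intro h
        exact ⟨⟨fun i => ω i.1, h⟩, fun i => rfl⟩
      · rintro ⟨w, hw⟩
        rw [← w.2]; exact hw (Fin.last n)
    rw [this]
    refine MeasurableSet.iUnion fun w => ?_
    exact MeasurableSpace.measurableSet_generateFrom ⟨n + 1, w.1, rfl⟩
  · refine MeasurableSpace.generateFrom_le ?_
    rintro _ ⟨n, w, rfl⟩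
    exact measurableSet_cyl m n w

lemma map_shift_restrict {m : ℕ} {p : Fin m → ℝ≥0∞} (hp : ∀ a, p a ≠ ⊤)
    {ρ : Measure (ℕ → Fin m)} (hρ : IsBernoulliWith p ρ) (a : Fin m) :
    (ρ.restrict {ω | ω 0 = a}).map shiftSeq = p a • ρ := by
  have := hρ.1
  have hcyl : ∀ (n : ℕ) (w : Fin n → Fin m),
      (ρ.restrict {ω | ω 0 = a}).map shiftSeq {ω | ∀ i : Fin n, ω i.1 = w i} =
       (p a • ρ) {ω | ∀ i : Fin n, ω i.1 = w i} := by
    intro n w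
    rw [Measure.map_apply measurable_shiftSeq (measurableSet_cyl m n w),
      Measure.restrict_apply (measurable_shiftSeq (measurableSet_cyl m n w)), Measure.smul_apply,
      hρ.2 n w]
    have e : shiftSeq ⁻¹' {ω | ∀ i : Fin n, ω i.1 = w i} ∩ {ω | ω 0 = a} =
        {ω | ∀ i : Fin (n + 1), ω i.1 = (Fin.cons a w : Fin (n + 1) → Fin m) i} := by
      ext ω
      constructor
      · rintro ⟨h1, h2⟩ i
        refine Fin.cases ?_ ?_ i
        · simpa using h2
        · intro j; simpa [shiftSeq] using h1 j
      · intro h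
        exact ⟨fun i => by simpa [shiftSeq] using h i.succ, by simpa using h 0⟩
    rw [e, hρ.2, Fin.prod_univ_succ]
    simp
  refine ext_of_generate_finite (cylSets m) (generateFrom_cylSets m) (isPiSystem_cylSets m) ?_ ?_
  · rintro _ ⟨n, w, rfl⟩
    exact hcyl n w
  · have := hcyl 0 (fun i => i.elim0)
    simpa using this

lemma prod_shift {m : ℕ} {p : Fin m → ℝ} (hp : ∀ i, 0 ≤ p i)
    {ρ : Measure (ℕ → Fin m)} (hρ : IsBernoulliWith (fun i => ENNReal.ofReal (p i)) ρ)
    {A : Set ((ℕ → Fin m) × (ℕ → Fin m))} (hA : MeasurableSet A) :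
    (ρ.prod ρ) {w | w.1 0 = w.2 0 ∧ (shiftSeq w.1, shiftSeq w.2) ∈ A} ≤
      ENNReal.ofReal (∑ i, p i ^ 2) * (ρ.prod ρ) A := by
  have := hρ.1
  have hms : Measurable (Prod.map shiftSeq shiftSeq :
      (ℕ → Fin m) × (ℕ → Fin m) → (ℕ → Fin m) × (ℕ → Fin m)) :=
    measurable_shiftSeq.prodMap measurable_shiftSeq
  have e : {w : (ℕ → Fin m) × (ℕ → Fin m) | w.1 0 = w.2 0 ∧ (shiftSeq w.1, shiftSeq w.2) ∈ A} ⊆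
      ⋃ a : Fin m, (Prod.map shiftSeq shiftSeq ⁻¹' A) ∩ ({ω | ω 0 = a} ×ˢ {ω | ω 0 = a}) := by
    rintro w ⟨h1, h2⟩
    exact mem_iUnion.2 ⟨w.1 0, h2, rfl, h1.symm⟩
  refine (measure_mono e).trans ((measure_iUnion_le _).trans ?_)
  rw [tsum_fintype, ENNReal.ofReal_sum_of_nonneg (fun i _ => by positivity), Finset.sum_mul]
  refine Finset.sum_le_sum fun a _ => le_of_eq ?_
  have h0 : (ρ.restrict {ω | ω 0 = a}).map shiftSeq = ENNReal.ofReal (p a) • ρ :=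
    map_shift_restrict (fun a => ENNReal.ofReal_ne_top) hρ a
  rw [← Measure.restrict_apply (hms hA), ← Measure.prod_restrict, ← Measure.map_apply hms hA,
    ← Measure.map_prod_map _ _ measurable_shiftSeq measurable_shiftSeq, h0,
    Measure.prod_smul_left, Measure.prod_smul_right, smul_smul, Measure.smul_apply,
    smul_eq_mul, ENNReal.ofReal_pow (hp a), sq]

/-- clamp -/
def cl (q x : ℝ) : ℝ := max 0 (min x q)

lemma cl_eq {q x : ℝ} (h0 : 0 ≤ x) (h1 : x ≤ q) : cl q x = x := by
  simp [cl, h0, h1]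

lemma cl_nonneg (q x : ℝ) : 0 ≤ cl q x := le_max_left _ _

lemma cl_le {q : ℝ} (hq : 0 ≤ q) (x : ℝ) : cl q x ≤ q := max_le hq (min_le_right _ _)

lemma continuous_cl (q : ℝ) : Continuous (cl q) := by unfold cl; fun_prop

lemma exists_bound {m : ℕ} (d : Fin m → ℝ) : ∃ B : ℝ, 0 ≤ B ∧ ∀ i, |d i| ≤ B :=
  ⟨∑ i, |d i|, Finset.sum_nonneg fun i _ => abs_nonneg _,
    fun i => Finset.single_le_sum (f := fun i => |d i|) (fun i _ => abs_nonneg _) (Finset.mem_univ i)⟩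

lemma summable_digits {m : ℕ} (d : Fin m → ℝ) (ω : ℕ → Fin m) {x : ℝ} (h0 : 0 ≤ x) (h1 : x < 1) :
    Summable (fun n => d (ω n) * x ^ n) := by
  obtain ⟨B, hB, hd⟩ := exists_bound d
  refine Summable.of_norm_bounded ((summable_geometric_of_lt_one h0 h1).mul_left B) fun n => ?_
  rw [norm_mul, norm_pow, Real.norm_eq_abs, Real.norm_eq_abs, abs_of_nonneg h0]
  gcongr
  exact hd _

lemma continuous_PiOne_cl {m : ℕ} (d : Fin m → ℝ) {q : ℝ} (h0 : 0 ≤ q) (h1 : q < 1) :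
    Continuous (fun z : (ℕ → Fin m) × ℝ => PiOne m d (cl q z.2) z.1) := by
  obtain ⟨B, hB, hd⟩ := exists_bound d
  unfold PiOne
  refine continuous_tsum (u := fun n => B * q ^ n) (fun n => ?_)
    ((summable_geometric_of_lt_one h0 h1).mul_left B) fun n z => ?_
  · have hc := continuous_cl q
    have : Continuous d := continuous_of_discreteTopology
    fun_prop
  · rw [norm_mul, norm_pow, Real.norm_eq_abs, Real.norm_eq_abs, abs_of_nonneg (cl_nonneg _ _)]
    have := cl_nonneg q z.2
    gcongr
    · exact hd _
    · exact cl_le h0 _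

lemma continuous_PiOne {m : ℕ} (d : Fin m → ℝ) {x : ℝ} (h0 : 0 ≤ x) (h1 : x < 1) :
    Continuous (PiOne m d x) := by
  have := (continuous_PiOne_cl d h0 h1).comp (Continuous.prodMk_left x)
  have e : PiOne m d x = (fun z : (ℕ → Fin m) × ℝ => PiOne m d (cl x z.2) z.1) ∘ (fun ω => (ω, x)) := by
    funext ω
    simp [cl_eq h0 le_rfl]
  rw [e]; exact this

/-- the difference series -/
def Fd {m : ℕ} (d : Fin m → ℝ) (w : (ℕ → Fin m) × (ℕ → Fin m)) (x : ℝ) : ℝ :=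
  PiOne m d x w.1 - PiOne m d x w.2

/-- its derivative -/
def Fd' {m : ℕ} (d : Fin m → ℝ) (w : (ℕ → Fin m) × (ℕ → Fin m)) (x : ℝ) : ℝ :=
  ∑' n : ℕ, (d (w.1 n) - d (w.2 n)) * (n * x ^ (n - 1))

lemma Fd_eq_Beval {m : ℕ} (d : Fin m → ℝ) (w : (ℕ → Fin m) × (ℕ → Fin m)) {x : ℝ}
    (h0 : 0 ≤ x) (h1 : x < 1) : Fd d w x = Beval (fun n => d (w.1 n) - d (w.2 n)) x := by
  unfold Fd PiOne Beval
  rw [← (summable_digits d w.1 h0 h1).tsum_sub (summable_digits d w.2 h0 h1)]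
  simp [sub_mul]

lemma summable_deriv_bound (B : ℝ) {q : ℝ} (h0 : 0 < q) (h1 : q < 1) :
    Summable (fun n : ℕ => B * (n * q ^ (n - 1))) := by
  have h := (summable_pow_mul_geometric_of_norm_lt_one 1 (r := q) (by
    rwa [Real.norm_eq_abs, abs_of_pos h0])).mul_left (B * q⁻¹)
  refine h.congr fun n => ?_
  rcases n with _ | n
  · simp
  · simp only [Nat.add_sub_cancel, pow_succ]
    field_simp

lemma Fd'_bound {m : ℕ} (d : Fin m → ℝ) : ∃ B : ℝ, 0 ≤ B ∧ ∀ i j, |d i - d j| ≤ B := by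
  obtain ⟨B, hB, hd⟩ := exists_bound d
  exact ⟨B + B, by positivity, fun i j => (abs_sub _ _).trans (add_le_add (hd i) (hd j))⟩

lemma hasDerivAt_Beval {m : ℕ} (d : Fin m → ℝ) (w : (ℕ → Fin m) × (ℕ → Fin m)) {x : ℝ}
    (h0 : 0 < x) (h1 : x < 1) :
    HasDerivAt (Beval (fun n => d (w.1 n) - d (w.2 n))) (Fd' d w x) x := by
  obtain ⟨B, hB, hd⟩ := Fd'_bound d
  obtain ⟨q, hxq, hq1⟩ := exists_between h1
  have hq0 : 0 < q := h0.trans hxq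
  unfold Beval Fd'
  refine hasDerivAt_tsum_of_isPreconnected (t := Ioo 0 q) (y₀ := x)
    (g := fun n z => (d (w.1 n) - d (w.2 n)) * z ^ n)
    (g' := fun n z => (d (w.1 n) - d (w.2 n)) * (n * z ^ (n - 1)))
    (summable_deriv_bound B hq0 hq1) isOpen_Ioo isPreconnected_Ioo ?_ ?_ ⟨h0, hxq⟩ ?_ ⟨h0, hxq⟩
  · intro n y hy
    exact (hasDerivAt_pow n y).const_mul _
  · intro n y hy
    have := hy.1
    rw [norm_mul, norm_mul, norm_pow, Real.norm_eq_abs, Real.norm_eq_abs, Real.norm_eq_abs,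
      abs_of_pos hy.1, Nat.abs_cast]
    gcongr
    · exact hd _ _
    · exact hy.2.le
  · simp only [sub_mul]
    exact (summable_digits d w.1 h0.le h1).sub (summable_digits d w.2 h0.le h1)

lemma hasDerivAt_Fd {m : ℕ} (d : Fin m → ℝ) (w : (ℕ → Fin m) × (ℕ → Fin m)) {x : ℝ}
    (h0 : 0 < x) (h1 : x < 1) : HasDerivAt (Fd d w) (Fd' d w x) x := by
  refine (hasDerivAt_Beval d w h0 h1).congr_of_eventuallyEq ?_
  filter_upwards [Ioo_mem_nhds h0 h1] with y hy
  exact Fd_eq_Beval d w hy.1.le hy.2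

lemma continuous_Fd_cl {m : ℕ} (d : Fin m → ℝ) {q : ℝ} (h0 : 0 ≤ q) (h1 : q < 1) :
    Continuous (fun z : ((ℕ → Fin m) × (ℕ → Fin m)) × ℝ => Fd d z.1 (cl q z.2)) := by
  unfold Fd
  have h := continuous_PiOne_cl d h0 h1
  exact (h.comp (f := fun z : ((ℕ → Fin m) × (ℕ → Fin m)) × ℝ => (z.1.1, z.2)) (by fun_prop)).sub
    (h.comp (f := fun z : ((ℕ → Fin m) × (ℕ → Fin m)) × ℝ => (z.1.2, z.2)) (by fun_prop))

lemma continuous_Fd'_cl {m : ℕ} (d : Fin m → ℝ) {q : ℝ} (h0 : 0 < q) (h1 : q < 1) :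
    Continuous (fun z : ((ℕ → Fin m) × (ℕ → Fin m)) × ℝ => Fd' d z.1 (cl q z.2)) := by
  obtain ⟨B, hB, hd⟩ := Fd'_bound d
  unfold Fd'
  refine continuous_tsum (fun n => ?_) (summable_deriv_bound B h0 h1) fun n z => ?_
  · have hc := continuous_cl q
    have : Continuous d := continuous_of_discreteTopology
    fun_prop
  · have := cl_nonneg q z.2
    rw [norm_mul, norm_mul, norm_pow, Real.norm_eq_abs, Real.norm_eq_abs, Real.norm_eq_abs,
      abs_of_nonneg this, Nat.abs_cast]
    gcongr
    · exact hd _ _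
    · exact cl_le h0.le _

lemma PiOne_shift {m : ℕ} (d : Fin m → ℝ) (ω : ℕ → Fin m) {x : ℝ} (h0 : 0 ≤ x) (h1 : x < 1) :
    PiOne m d x ω = d (ω 0) + x * PiOne m d x (shiftSeq ω) := by
  unfold PiOne
  rw [(summable_digits d ω h0 h1).tsum_eq_zero_add, ← tsum_mul_left]
  simp only [pow_zero, mul_one, shiftSeq]
  congr 2
  ext n
  ring

lemma Fd_shift {m : ℕ} (d : Fin m → ℝ) (w : (ℕ → Fin m) × (ℕ → Fin m)) {x : ℝ} (h0 : 0 ≤ x)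
    (h1 : x < 1) (hw : w.1 0 = w.2 0) :
    Fd d w x = x * Fd d (shiftSeq w.1, shiftSeq w.2) x := by
  unfold Fd
  rw [PiOne_shift d w.1 h0 h1, PiOne_shift d w.2 h0 h1, hw]
  ring

def Tr {m : ℕ} (d : Fin m → ℝ) (x₀ : ℝ) (w : (ℕ → Fin m) × (ℕ → Fin m)) (δ η : ℝ) : Prop :=
  (∀ x ∈ Icc (x₀ - η) (x₀ + η), δ ≤ |Fd d w x|) ∨ (∀ x ∈ Icc (x₀ - η) (x₀ + η), δ ≤ |Fd' d w x|)

lemma Tr.mono {m : ℕ} {d : Fin m → ℝ} {x₀ : ℝ} {w : (ℕ → Fin m) × (ℕ → Fin m)} {δ η δ' η' : ℝ}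
    (h : Tr d x₀ w δ η) (hδ : δ' ≤ δ) (hη : η' ≤ η) : Tr d x₀ w δ' η' := by
  have hs : Icc (x₀ - η') (x₀ + η') ⊆ Icc (x₀ - η) (x₀ + η) :=
    Icc_subset_Icc (by linarith) (by linarith)
  rcases h with h | h
  · exact Or.inl fun x hx => hδ.trans (h x (hs hx))
  · exact Or.inr fun x hx => hδ.trans (h x (hs hx))

lemma Tr_aux {X : Type*} [TopologicalSpace X] (q x₀ : ℝ) (h0 : 0 < x₀) (hq : x₀ < q)
    (Φ : X → ℝ → ℝ) (hΦ : Continuous (fun z : X × ℝ => Φ z.1 (cl q z.2))) (w : X)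
    (hne : Φ w x₀ ≠ 0) :
    ∃ δ > 0, ∃ η > 0, ∀ᶠ w' in 𝓝 w, ∀ x ∈ Icc (x₀ - η) (x₀ + η), δ ≤ |Φ w' x| := by
  have hpos : 0 < |Φ w x₀| := abs_pos.2 hne
  have h1 : ∀ᶠ z in 𝓝 (w, x₀), |Φ w x₀| / 2 < |Φ z.1 (cl q z.2)| := by
    refine (hΦ.abs.tendsto (w, x₀)).eventually (lt_mem_nhds ?_)
    simp only [cl_eq h0.le hq.le]
    linarith
  have h2 : ∀ᶠ z in 𝓝 (w, x₀), z.2 ∈ Ioo 0 q :=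
    (continuous_snd.tendsto (w, x₀)).eventually (Ioo_mem_nhds h0 hq)
  have h3 := h1.and h2
  rw [nhds_prod_eq, eventually_prod_iff] at h3
  obtain ⟨pa, ha, pb, hb, hab⟩ := h3
  obtain ⟨η, hη, hηb⟩ := Metric.nhds_basis_closedBall.eventually_iff.1 hb
  refine ⟨|Φ w x₀| / 2, by positivity, η, hη, ?_⟩
  filter_upwards [ha] with w' hw' x hx
  have h4 := hab hw' (hηb (by rwa [Real.closedBall_eq_Icc] : x ∈ Metric.closedBall x₀ η))
  rw [cl_eq h4.2.1.le h4.2.2.le] at h4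
  exact h4.1.le

lemma Tr_local {m : ℕ} (d : Fin m → ℝ) (x₀ : ℝ) (h0 : 0 < x₀) (h1 : x₀ < 1)
    (w : (ℕ → Fin m) × (ℕ → Fin m)) (hw : Fd d w x₀ ≠ 0 ∨ Fd' d w x₀ ≠ 0) :
    ∃ δ > 0, ∃ η > 0, ∀ᶠ w' in 𝓝 w, Tr d x₀ w' δ η := by
  obtain ⟨q, hxq, hq1⟩ := exists_between h1
  rcases hw with hw | hw
  · obtain ⟨δ, hδ, η, hη, h⟩ := Tr_aux q x₀ h0 hxq _ (continuous_Fd_cl d (h0.trans hxq).le hq1) w hw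
    exact ⟨δ, hδ, η, hη, h.mono fun w' h => Or.inl h⟩
  · obtain ⟨δ, hδ, η, hη, h⟩ := Tr_aux q x₀ h0 hxq _ (continuous_Fd'_cl d (h0.trans hxq) hq1) w hw
    exact ⟨δ, hδ, η, hη, h.mono fun w' h => Or.inr h⟩

lemma isClopen_ne (m : ℕ) : IsClopen {w : (ℕ → Fin m) × (ℕ → Fin m) | w.1 0 ≠ w.2 0} := by
  have hc : Continuous (fun w : (ℕ → Fin m) × (ℕ → Fin m) => (w.1 0, w.2 0)) := by fun_prop
  exact (isClopen_discrete {z : Fin m × Fin m | z.1 ≠ z.2}).preimage hc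

lemma Tr_uniform {m : ℕ} (d : Fin m → ℝ) (x₀ y₀ : ℝ) (hx0 : 0 < x₀) (hx1 : x₀ < 1)
    (hy0 : 0 < y₀) (hy1 : y₀ < 1) (κ : Prop)
    (H : ∀ w : (ℕ → Fin m) × (ℕ → Fin m), w.1 0 ≠ w.2 0 →
      (Fd d w x₀ ≠ 0 ∨ Fd' d w x₀ ≠ 0) ∨ (κ ∧ (Fd d w y₀ ≠ 0 ∨ Fd' d w y₀ ≠ 0))) :
    ∃ δ > 0, ∃ η > 0, ∀ w : (ℕ → Fin m) × (ℕ → Fin m), w.1 0 ≠ w.2 0 →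
      Tr d x₀ w δ η ∨ (κ ∧ Tr d y₀ w δ η) := by
  have hK := (isClopen_ne m).1.isCompact
  refine hK.induction_on (p := fun s => ∃ δ > 0, ∃ η > 0, ∀ w ∈ s,
      Tr d x₀ w δ η ∨ (κ ∧ Tr d y₀ w δ η)) ?_ ?_ ?_ ?_
  · exact ⟨1, one_pos, 1, one_pos, fun w hw => absurd hw (notMem_empty w)⟩
  · rintro s t hst ⟨δ, hδ, η, hη, h⟩
    exact ⟨δ, hδ, η, hη, fun w hw => h w (hst hw)⟩
  · rintro s t ⟨δ, hδ, η, hη, h⟩ ⟨δ', hδ', η', hη', h'⟩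
    refine ⟨min δ δ', lt_min hδ hδ', min η η', lt_min hη hη', ?_⟩
    rintro w (hw | hw)
    · exact (h w hw).imp (fun a => a.mono (min_le_left _ _) (min_le_left _ _))
        (fun a => ⟨a.1, a.2.mono (min_le_left _ _) (min_le_left _ _)⟩)
    · exact (h' w hw).imp (fun a => a.mono (min_le_right _ _) (min_le_right _ _))
        (fun a => ⟨a.1, a.2.mono (min_le_right _ _) (min_le_right _ _)⟩)
  · intro w hw
    rcases H w hw with h | ⟨hκ, h⟩
    · obtain ⟨δ, hδ, η, hη, h⟩ := Tr_local d x₀ hx0 hx1 w h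
      exact ⟨_, mem_nhdsWithin_of_mem_nhds h, δ, hδ, η, hη, fun w' hw' => Or.inl hw'⟩
    · obtain ⟨δ, hδ, η, hη, h⟩ := Tr_local d y₀ hy0 hy1 w h
      exact ⟨_, mem_nhdsWithin_of_mem_nhds h, δ, hδ, η, hη, fun w' hw' => Or.inr ⟨hκ, hw'⟩⟩

lemma Fd_pair_le {m : ℕ} (d : Fin m → ℝ) (ρ : Measure (ℕ → Fin m)) [IsProbabilityMeasure ρ]
    {x v : ℝ} (h0 : 0 ≤ x) (h1 : x < 1) (hv : 0 < v) :
    (ρ.prod ρ) {w | |Fd d w x| ≤ v} ≤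
      ENNReal.ofReal (4 * v) * densityL2sq (ρ.map (PiOne m d x)) := by
  have hm : Measurable (PiOne m d x) := (continuous_PiOne d h0 h1).measurable
  have : IsProbabilityMeasure (ρ.map (PiOne m d x)) := Measure.isProbabilityMeasure_map hm.aemeasurable
  refine le_trans (le_of_eq ?_) (prod_le_densityL2sq _ v hv)
  rw [Measure.map_prod_map _ _ hm hm, Measure.map_apply (hm.prodMap hm)]
  · rfl
  · exact (isClosed_le (by fun_prop) (by fun_prop)).measurableSet

lemma lintegral_h_le {m : ℕ} (d : Fin m → ℝ) (ρ : Measure (ℕ → Fin m)) [IsProbabilityMeasure ρ]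
    {q a b v : ℝ} (hq0 : 0 ≤ q) (hq1 : q < 1) (ha : 0 ≤ a) (hb : b ≤ q) (hv : 0 < v) :
    ∫⁻ w, (volume.restrict (Icc a b)) {y | |Fd d w (cl q y)| ≤ v} ∂(ρ.prod ρ) ≤
      ENNReal.ofReal (4 * v) * ∫⁻ l in Icc a b, densityL2sq (ρ.map (PiOne m d l)) := by
  have hE : MeasurableSet {z : ((ℕ → Fin m) × (ℕ → Fin m)) × ℝ | |Fd d z.1 (cl q z.2)| ≤ v} :=
    (isClosed_le (continuous_Fd_cl d hq0 hq1).abs continuous_const).measurableSet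
  have e1 := Measure.prod_apply (μ := ρ.prod ρ) (ν := volume.restrict (Icc a b)) hE
  have e2 := Measure.prod_apply_symm (μ := ρ.prod ρ) (ν := volume.restrict (Icc a b)) hE
  rw [e1] at e2
  refine (le_of_eq e2).trans ?_
  rw [← lintegral_const_mul' _ _ ENNReal.ofReal_ne_top]
  refine setLIntegral_mono' measurableSet_Icc fun l hl => ?_
  have : (fun w => (w, l)) ⁻¹' {z : ((ℕ → Fin m) × (ℕ → Fin m)) × ℝ | |Fd d z.1 (cl q z.2)| ≤ v} =
      {w | |Fd d w l| ≤ v} := by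
    ext w
    simp [cl_eq (ha.trans hl.1) (hl.2.trans hb)]
  rw [this]
  exact Fd_pair_le d ρ (ha.trans hl.1) ((hl.2.trans hb).trans_lt hq1) hv

lemma N_bound {m : ℕ} (d : Fin m → ℝ) (ρ : Measure (ℕ → Fin m)) [IsProbabilityMeasure ρ]
    {q g0 g1 l0 l1 C : ℝ} (hq0 : 0 ≤ q) (hq1 : q < 1) (hg0 : 0 ≤ g0) (hg1 : g1 ≤ q)
    (hl0 : 0 ≤ l0) (hl1 : l1 ≤ q) (hC : 0 ≤ C) (κ : Prop)
    (hT : ∀ w : (ℕ → Fin m) × (ℕ → Fin m), w.1 0 ≠ w.2 0 →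
      (∀ u > 0, volume {x | x ∈ Icc g0 g1 ∧ |Fd d w x| ≤ u} ≤ ENNReal.ofReal (C * u)) ∨
      (κ ∧ ∀ u > 0, volume {x | x ∈ Icc l0 l1 ∧ |Fd d w x| ≤ u} ≤ ENNReal.ofReal (C * u)))
    (hL : ∫⁻ l in Icc l0 l1, densityL2sq (ρ.map (PiOne m d l)) < ⊤)
    (hG : κ → ∫⁻ l in Icc g0 g1, densityL2sq (ρ.map (PiOne m d l)) < ⊤) :
    ∃ C' : ℝ≥0∞, C' ≠ ⊤ ∧ ∀ u > 0, ∀ v > 0,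
      ∫⁻ z, (ρ.prod ρ) {w | w.1 0 ≠ w.2 0 ∧ |Fd d w (cl q z.1)| ≤ u ∧ |Fd d w (cl q z.2)| ≤ v}
        ∂((volume.restrict (Icc g0 g1)).prod (volume.restrict (Icc l0 l1))) ≤
      C' * ENNReal.ofReal (u * v) := by
  classical
  set ML := ∫⁻ l in Icc l0 l1, densityL2sq (ρ.map (PiOne m d l))
  set MG := ∫⁻ l in Icc g0 g1, densityL2sq (ρ.map (PiOne m d l))
  set k : ℝ≥0∞ := if κ then 1 else 0 with hk
  have hkM : k * MG ≠ ⊤ := by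
    by_cases h : κ
    · simp [hk, h, (hG h).ne]
    · simp [hk, h]
  have hvol : ∀ (a b : ℝ) (_ : 0 ≤ a) (_ : b ≤ q) (w : (ℕ → Fin m) × (ℕ → Fin m)) (u : ℝ),
      (volume.restrict (Icc a b)) {x | |Fd d w (cl q x)| ≤ u} =
        volume {x | x ∈ Icc a b ∧ |Fd d w x| ≤ u} := by
    intro a b ha hb w u
    rw [Measure.restrict_apply' measurableSet_Icc]
    congr 1
    ext x
    constructor
    · rintro ⟨h1, h2⟩
      refine ⟨h2, ?_⟩
      have h1 : |Fd d w (cl q x)| ≤ u := h1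
      rwa [cl_eq (ha.trans h2.1) (h2.2.trans hb)] at h1
    · rintro ⟨h2, h1⟩
      refine ⟨?_, h2⟩
      change |Fd d w (cl q x)| ≤ u
      rwa [cl_eq (ha.trans h2.1) (h2.2.trans hb)]
  refine ⟨ENNReal.ofReal (4 * C) * (ML + k * MG), ENNReal.mul_ne_top ENNReal.ofReal_ne_top
    (ENNReal.add_ne_top.2 ⟨hL.ne, hkM⟩), fun u hu v hv => ?_⟩
  have hcF := continuous_Fd_cl d hq0 hq1
  have hE : MeasurableSet {z : (ℝ × ℝ) × ((ℕ → Fin m) × (ℕ → Fin m)) | z.2.1 0 ≠ z.2.2 0 ∧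
      |Fd d z.2 (cl q z.1.1)| ≤ u ∧ |Fd d z.2 (cl q z.1.2)| ≤ v} := by
    refine IsClosed.measurableSet (IsClosed.inter ?_ (IsClosed.inter ?_ ?_))
    · exact (isClopen_ne m).1.preimage continuous_snd
    · exact isClosed_le (hcF.comp (f := fun z : (ℝ × ℝ) × ((ℕ → Fin m) × (ℕ → Fin m)) =>
        (z.2, z.1.1)) (by fun_prop)).abs continuous_const
    · exact isClosed_le (hcF.comp (f := fun z : (ℝ × ℝ) × ((ℕ → Fin m) × (ℕ → Fin m)) =>
        (z.2, z.1.2)) (by fun_prop)).abs continuous_const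
  set Q := (volume.restrict (Icc g0 g1)).prod (volume.restrict (Icc l0 l1)) with hQ
  have e1 := Measure.prod_apply (μ := Q) (ν := ρ.prod ρ) hE
  have e2 := Measure.prod_apply_symm (μ := Q) (ν := ρ.prod ρ) hE
  rw [e1] at e2
  refine (le_of_eq e2).trans ?_
  have hmh : ∀ (a b u : ℝ), Measurable (fun w : (ℕ → Fin m) × (ℕ → Fin m) =>
      (volume.restrict (Icc a b)) {y | |Fd d w (cl q y)| ≤ u}) := by
    intro a b u
    exact measurable_measure_prodMk_left (ν := volume.restrict (Icc a b))
      (isClosed_le hcF.abs (continuous_const (y := u))).measurableSet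
  calc _ ≤ ∫⁻ w, (ENNReal.ofReal (C * u) * (volume.restrict (Icc l0 l1)) {y | |Fd d w (cl q y)| ≤ v} +
        k * ENNReal.ofReal (C * v) * (volume.restrict (Icc g0 g1)) {y | |Fd d w (cl q y)| ≤ u}) ∂(ρ.prod ρ) := by
        refine lintegral_mono fun w => ?_
        by_cases hw : w.1 0 ≠ w.2 0
        · have e : (fun z => (z, w)) ⁻¹' {z : (ℝ × ℝ) × ((ℕ → Fin m) × (ℕ → Fin m)) | z.2.1 0 ≠ z.2.2 0 ∧
            |Fd d z.2 (cl q z.1.1)| ≤ u ∧ |Fd d z.2 (cl q z.1.2)| ≤ v} =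
            {x | |Fd d w (cl q x)| ≤ u} ×ˢ {y | |Fd d w (cl q y)| ≤ v} := by
            ext z
            exact ⟨fun h => h.2, fun h => ⟨hw, h⟩⟩
          simp only [e]
          rw [hQ, Measure.prod_prod]
          rcases hT w hw with h | ⟨hκ, h⟩
          · refine le_trans ?_ le_self_add
            gcongr
            rw [hvol g0 g1 hg0 hg1]
            exact h u hu
          · refine le_trans ?_ le_add_self
            rw [mul_comm]
            simp only [hk, hκ, if_true, one_mul]
            gcongr
            rw [hvol l0 l1 hl0 hl1]
            exact h v hv
        · have e : (fun z => (z, w)) ⁻¹' {z : (ℝ × ℝ) × ((ℕ → Fin m) × (ℕ → Fin m)) | z.2.1 0 ≠ z.2.2 0 ∧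
            |Fd d z.2 (cl q z.1.1)| ≤ u ∧ |Fd d z.2 (cl q z.1.2)| ≤ v} = ∅ := by
            ext z
            exact ⟨fun h => hw h.1, fun h => absurd h (notMem_empty z)⟩
          simp only [e, measure_empty]
          exact zero_le
    _ = ENNReal.ofReal (C * u) * ∫⁻ w, (volume.restrict (Icc l0 l1)) {y | |Fd d w (cl q y)| ≤ v} ∂(ρ.prod ρ) +
        k * ENNReal.ofReal (C * v) * ∫⁻ w, (volume.restrict (Icc g0 g1)) {y | |Fd d w (cl q y)| ≤ u} ∂(ρ.prod ρ) := by
        rw [lintegral_add_left ((hmh _ _ _).const_mul _), lintegral_const_mul _ (hmh _ _ _),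
          lintegral_const_mul _ (hmh _ _ _)]
    _ ≤ ENNReal.ofReal (C * u) * (ENNReal.ofReal (4 * v) * ML) +
        k * ENNReal.ofReal (C * v) * (ENNReal.ofReal (4 * u) * MG) := by
        gcongr
        · exact lintegral_h_le d ρ hq0 hq1 hl0 hl1 hv
        · exact lintegral_h_le d ρ hq0 hq1 hg0 hg1 hu
    _ = ENNReal.ofReal (4 * C) * (ML + k * MG) * ENNReal.ofReal (u * v) := by
        rw [ENNReal.ofReal_mul hC, ENNReal.ofReal_mul hC, ENNReal.ofReal_mul (by norm_num : (0:ℝ) ≤ 4),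
          ENNReal.ofReal_mul (by norm_num : (0:ℝ) ≤ 4), ENNReal.ofReal_mul (by norm_num : (0:ℝ) ≤ 4),
          ENNReal.ofReal_mul hu.le]
        ring

lemma K_rec {m : ℕ} (d : Fin m → ℝ) {p : Fin m → ℝ} (hp : ∀ i, 0 ≤ p i)
    {ρ : Measure (ℕ → Fin m)} (hρ : IsBernoulliWith (fun i => ENNReal.ofReal (p i)) ρ)
    {g0 l0 x y : ℝ} (hg0 : 0 < g0) (hl0 : 0 < l0) (hx : g0 ≤ x) (hy : l0 ≤ y) (hx1 : x < 1)
    (hy1 : y < 1) (u v : ℝ) :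
    (ρ.prod ρ) {w | |Fd d w x| ≤ u ∧ |Fd d w y| ≤ v} ≤
      (ρ.prod ρ) {w | w.1 0 ≠ w.2 0 ∧ |Fd d w x| ≤ u ∧ |Fd d w y| ≤ v} +
      ENNReal.ofReal (∑ i, p i ^ 2) *
        (ρ.prod ρ) {w | |Fd d w x| ≤ u / g0 ∧ |Fd d w y| ≤ v / l0} := by
  have := hρ.1
  have hx0 := hg0.trans_le hx
  have hy0 := hl0.trans_le hy
  have hcx : ∀ z : ℝ, 0 ≤ z → z < 1 → Continuous (fun w : (ℕ → Fin m) × (ℕ → Fin m) => Fd d w z) := by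
    intro z h0 h1
    have h := continuous_PiOne d h0 h1
    unfold Fd
    exact (h.comp continuous_fst).sub (h.comp continuous_snd)
  have hA : MeasurableSet {w : (ℕ → Fin m) × (ℕ → Fin m) | |Fd d w x| ≤ u / g0 ∧ |Fd d w y| ≤ v / l0} :=
    ((isClosed_le (hcx x hx0.le hx1).abs continuous_const).inter
      (isClosed_le (hcx y hy0.le hy1).abs continuous_const)).measurableSet
  refine le_trans ?_ (add_le_add le_rfl (prod_shift hp hρ hA))
  refine le_trans (measure_mono ?_) (measure_union_le _ _)
  rintro w ⟨h1, h2⟩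
  by_cases hw : w.1 0 = w.2 0
  · right
    refine ⟨hw, ?_, ?_⟩
    · rw [Fd_shift d w hx0.le hx1 hw, abs_mul, abs_of_pos hx0] at h1
      rw [le_div_iff₀ hg0]
      have := abs_nonneg (Fd d (shiftSeq w.1, shiftSeq w.2) x)
      nlinarith
    · rw [Fd_shift d w hy0.le hy1 hw, abs_mul, abs_of_pos hy0] at h2
      rw [le_div_iff₀ hl0]
      have := abs_nonneg (Fd d (shiftSeq w.1, shiftSeq w.2) y)
      nlinarith
  · left
    exact ⟨hw, h1, h2⟩

lemma K_iter {m : ℕ} (d : Fin m → ℝ) {p : Fin m → ℝ} (hp : ∀ i, 0 ≤ p i)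
    {ρ : Measure (ℕ → Fin m)} (hρ : IsBernoulliWith (fun i => ENNReal.ofReal (p i)) ρ)
    {g0 l0 x y : ℝ} (hg0 : 0 < g0) (hl0 : 0 < l0) (hx : g0 ≤ x) (hy : l0 ≤ y) (hx1 : x < 1)
    (hy1 : y < 1) (n : ℕ) : ∀ (u v : ℝ),
    (ρ.prod ρ) {w | |Fd d w x| ≤ u ∧ |Fd d w y| ≤ v} ≤
      ∑ k ∈ Finset.range n, ENNReal.ofReal (∑ i, p i ^ 2) ^ k *
      (ρ.prod ρ) {w | w.1 0 ≠ w.2 0 ∧ |Fd d w x| ≤ u / g0 ^ k ∧ |Fd d w y| ≤ v / l0 ^ k} +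
      ENNReal.ofReal (∑ i, p i ^ 2) ^ n := by
  have := hρ.1
  induction n with
  | zero => intro u v; simpa using prob_le_one
  | succ n ih =>
    intro u v
    refine (K_rec d hp hρ hg0 hl0 hx hy hx1 hy1 u v).trans ?_
    refine (add_le_add le_rfl (mul_le_mul_right (ih (u / g0) (v / l0)) _)).trans (le_of_eq ?_)
    rw [Finset.sum_range_succ', mul_add, Finset.mul_sum]
    have e : ∀ k, ENNReal.ofReal (∑ i, p i ^ 2) * (ENNReal.ofReal (∑ i, p i ^ 2) ^ k *
      (ρ.prod ρ) {w | w.1 0 ≠ w.2 0 ∧ |Fd d w x| ≤ u / g0 / g0 ^ k ∧ |Fd d w y| ≤ v / l0 / l0 ^ k}) =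
      ENNReal.ofReal (∑ i, p i ^ 2) ^ (k + 1) *
      (ρ.prod ρ) {w | w.1 0 ≠ w.2 0 ∧ |Fd d w x| ≤ u / g0 ^ (k + 1) ∧ |Fd d w y| ≤ v / l0 ^ (k + 1)} := by
      intro k
      rw [div_div, div_div, ← pow_succ', ← pow_succ', ← mul_assoc, ← pow_succ']
    simp only [e, pow_zero, div_one, one_mul]
    rw [pow_succ']
    ring

lemma K_integral {m : ℕ} (d : Fin m → ℝ) {p : Fin m → ℝ} (hp : ∀ i, 0 ≤ p i)
    {ρ : Measure (ℕ → Fin m)} (hρ : IsBernoulliWith (fun i => ENNReal.ofReal (p i)) ρ)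
    {q g0 g1 l0 l1 : ℝ} (hq0 : 0 ≤ q) (hq1 : q < 1) (hg0 : 0 < g0) (hg1 : g1 ≤ q)
    (hl0 : 0 < l0) (hl1 : l1 ≤ q) (hs : ∑ i, p i ^ 2 < g0 * l0) (hs1 : ∑ i, p i ^ 2 < 1)
    (C' : ℝ≥0∞)
    (hC' : ∀ u > 0, ∀ v > 0,
      ∫⁻ z, (ρ.prod ρ) {w | w.1 0 ≠ w.2 0 ∧ |Fd d w (cl q z.1)| ≤ u ∧ |Fd d w (cl q z.2)| ≤ v}
        ∂((volume.restrict (Icc g0 g1)).prod (volume.restrict (Icc l0 l1))) ≤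
      C' * ENNReal.ofReal (u * v)) (r : ℝ) (hr : 0 < r) :
    ∫⁻ z, (ρ.prod ρ) {w | |Fd d w (cl q z.1)| ≤ r ∧ |Fd d w (cl q z.2)| ≤ r}
        ∂((volume.restrict (Icc g0 g1)).prod (volume.restrict (Icc l0 l1))) ≤
      C' * (1 - ENNReal.ofReal ((∑ i, p i ^ 2) / (g0 * l0)))⁻¹ * ENNReal.ofReal (r * r) := by
  have := hρ.1
  set Q := (volume.restrict (Icc g0 g1)).prod (volume.restrict (Icc l0 l1)) with hQ
  set s := ∑ i, p i ^ 2 with hsdef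
  have hs0 : 0 ≤ s := Finset.sum_nonneg fun i _ => by positivity
  set θ := s / (g0 * l0) with hθ
  have hcF := continuous_Fd_cl d hq0 hq1
  have hmN : ∀ u v : ℝ, Measurable (fun z : ℝ × ℝ => (ρ.prod ρ) {w | w.1 0 ≠ w.2 0 ∧
      |Fd d w (cl q z.1)| ≤ u ∧ |Fd d w (cl q z.2)| ≤ v}) := by
    intro u v
    have hE : MeasurableSet {z : (ℝ × ℝ) × ((ℕ → Fin m) × (ℕ → Fin m)) | z.2.1 0 ≠ z.2.2 0 ∧
        |Fd d z.2 (cl q z.1.1)| ≤ u ∧ |Fd d z.2 (cl q z.1.2)| ≤ v} := by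
      refine IsClosed.measurableSet (IsClosed.inter ?_ (IsClosed.inter ?_ ?_))
      · exact (isClopen_ne m).1.preimage continuous_snd
      · exact isClosed_le (hcF.comp (f := fun z : (ℝ × ℝ) × ((ℕ → Fin m) × (ℕ → Fin m)) =>
          (z.2, z.1.1)) (by fun_prop)).abs continuous_const
      · exact isClosed_le (hcF.comp (f := fun z : (ℝ × ℝ) × ((ℕ → Fin m) × (ℕ → Fin m)) =>
          (z.2, z.1.2)) (by fun_prop)).abs continuous_const
    exact measurable_measure_prodMk_left (ν := ρ.prod ρ) hE
  have hn : ∀ n : ℕ, ∫⁻ z, (ρ.prod ρ) {w | |Fd d w (cl q z.1)| ≤ r ∧ |Fd d w (cl q z.2)| ≤ r} ∂Q ≤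
      C' * (1 - ENNReal.ofReal θ)⁻¹ * ENNReal.ofReal (r * r) + ENNReal.ofReal s ^ n * Q univ := by
    intro n
    calc _ ≤ ∫⁻ z, (∑ k ∈ Finset.range n, ENNReal.ofReal s ^ k *
            (ρ.prod ρ) {w | w.1 0 ≠ w.2 0 ∧ |Fd d w (cl q z.1)| ≤ r / g0 ^ k ∧
              |Fd d w (cl q z.2)| ≤ r / l0 ^ k} + ENNReal.ofReal s ^ n) ∂Q := by
          have hQ' : Q = (volume.prod volume).restrict (Icc g0 g1 ×ˢ Icc l0 l1) :=
            Measure.prod_restrict _ _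
          rw [hQ']
          refine setLIntegral_mono' (measurableSet_Icc.prod measurableSet_Icc) fun z hz => ?_
          obtain ⟨⟨h1, h2⟩, ⟨h3, h4⟩⟩ := hz
          have e1 := cl_eq (hg0.le.trans h1) (h2.trans hg1)
          have e2 := cl_eq (hl0.le.trans h3) (h4.trans hl1)
          simp only [e1, e2]
          exact K_iter d hp hρ hg0 hl0 h1 h3 ((h2.trans hg1).trans_lt hq1)
            ((h4.trans hl1).trans_lt hq1) n r r
      _ = ∑ k ∈ Finset.range n, ENNReal.ofReal s ^ k *
            ∫⁻ z, (ρ.prod ρ) {w | w.1 0 ≠ w.2 0 ∧ |Fd d w (cl q z.1)| ≤ r / g0 ^ k ∧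
              |Fd d w (cl q z.2)| ≤ r / l0 ^ k} ∂Q + ENNReal.ofReal s ^ n * Q univ := by
          rw [lintegral_add_right _ measurable_const, lintegral_const,
            lintegral_finsetSum _ (fun k _ => (hmN _ _).const_mul _)]
          congr 1
          refine Finset.sum_congr rfl fun k _ => ?_
          rw [lintegral_const_mul _ (hmN _ _)]
      _ ≤ ∑ k ∈ Finset.range n, ENNReal.ofReal s ^ k *
            (C' * ENNReal.ofReal (r / g0 ^ k * (r / l0 ^ k))) + ENNReal.ofReal s ^ n * Q univ := by
          gcongr with k _
          exact hC' _ (by positivity) _ (by positivity)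
      _ = C' * (∑ k ∈ Finset.range n, ENNReal.ofReal θ ^ k) * ENNReal.ofReal (r * r) +
            ENNReal.ofReal s ^ n * Q univ := by
          congr 1
          rw [Finset.mul_sum, Finset.sum_mul]
          refine Finset.sum_congr rfl fun k _ => ?_
          have e : s ^ k * (r / g0 ^ k * (r / l0 ^ k)) = θ ^ k * (r * r) := by
            rw [hθ, div_pow, mul_pow]; field_simp
          have e' : ENNReal.ofReal s ^ k * ENNReal.ofReal (r / g0 ^ k * (r / l0 ^ k)) =
              ENNReal.ofReal θ ^ k * ENNReal.ofReal (r * r) := by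
            rw [← ENNReal.ofReal_pow hs0, ← ENNReal.ofReal_mul (by positivity), e,
              ENNReal.ofReal_mul (by positivity), ENNReal.ofReal_pow (by positivity)]
          rw [mul_left_comm, e', mul_assoc]
      _ ≤ _ := by
          gcongr
          rw [← ENNReal.tsum_geometric]
          exact ENNReal.sum_le_tsum _
  have hQfin : Q univ ≠ ⊤ := by
    rw [hQ, ← univ_prod_univ, Measure.prod_prod]
    simp [ENNReal.mul_ne_top]
  have hlim : Tendsto (fun n : ℕ => C' * (1 - ENNReal.ofReal θ)⁻¹ * ENNReal.ofReal (r * r) +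
      ENNReal.ofReal s ^ n * Q univ) atTop
      (𝓝 (C' * (1 - ENNReal.ofReal θ)⁻¹ * ENNReal.ofReal (r * r) + 0 * Q univ)) := by
    refine Tendsto.add tendsto_const_nhds ?_
    refine ENNReal.Tendsto.mul_const ?_ (Or.inr hQfin)
    exact ENNReal.tendsto_pow_atTop_nhds_zero_of_lt_one (by simpa using hs1)
  simpa using ge_of_tendsto' hlim hn

lemma energy_eq {m : ℕ} (d : Fin m → ℝ) (ρ : Measure (ℕ → Fin m)) [IsProbabilityMeasure ρ]
    {x y r : ℝ} (hx0 : 0 ≤ x) (hx1 : x < 1) (hy0 : 0 ≤ y) (hy1 : y < 1) (hr : 0 < r) :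
    ∫⁻ z, (ρ.map (PiTwo m d x y)) (Metric.closedBall z r) / volume (Metric.closedBall z r)
      ∂(ρ.map (PiTwo m d x y)) =
    (ρ.prod ρ) {w | |Fd d w x| ≤ r ∧ |Fd d w y| ≤ r} * (ENNReal.ofReal (4 * (r * r)))⁻¹ := by
  have hm : Measurable (PiTwo m d x y) :=
    ((continuous_PiOne d hx0 hx1).prodMk (continuous_PiOne d hy0 hy1)).measurable
  have : IsProbabilityMeasure (ρ.map (PiTwo m d x y)) :=
    Measure.isProbabilityMeasure_map hm.aemeasurable
  set μ := ρ.map (PiTwo m d x y) with hμ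
  have hv : ∀ z : ℝ × ℝ, volume (Metric.closedBall z r) = ENNReal.ofReal (4 * (r * r)) := by
    intro z
    rw [← Prod.mk.eta (p := z), ← closedBall_prod_same, Measure.volume_eq_prod, Measure.prod_prod,
      Real.volume_closedBall, Real.volume_closedBall, ← ENNReal.ofReal_mul (by positivity)]
    ring_nf
  have hc : MeasurableSet {z : (ℝ × ℝ) × (ℝ × ℝ) | dist z.2 z.1 ≤ r} :=
    (isClosed_le (by fun_prop) (by fun_prop)).measurableSet
  simp only [hv, div_eq_mul_inv]
  have hmeas : Measurable (fun z : ℝ × ℝ => μ (Metric.closedBall z r)) :=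
    measurable_measure_prodMk_left (ν := μ) hc
  rw [lintegral_mul_const _ hmeas]
  congr 1
  have e : ∫⁻ z, μ (Metric.closedBall z r) ∂μ = (μ.prod μ) {z | dist z.2 z.1 ≤ r} :=
    (Measure.prod_apply (μ := μ) (ν := μ) hc).symm
  rw [e, hμ, Measure.map_prod_map _ _ hm hm, Measure.map_apply (hm.prodMap hm) hc]
  congr 1
  ext w
  simp only [mem_preimage, mem_ofPred_eq, Prod.map, PiTwo, Prod.dist_eq, max_le_iff, Real.dist_eq, Fd,
    abs_sub_comm]

lemma local_ae {m : ℕ} (d : Fin m → ℝ) {p : Fin m → ℝ} (hp : ∀ i, 0 ≤ p i)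
    {ρ : Measure (ℕ → Fin m)} (hρ : IsBernoulliWith (fun i => ENNReal.ofReal (p i)) ρ)
    {q g0 g1 l0 l1 : ℝ} (hq0 : 0 ≤ q) (hq1 : q < 1) (hg0 : 0 < g0) (hg1 : g1 ≤ q)
    (hl0 : 0 < l0) (hl1 : l1 ≤ q) (hs : ∑ i, p i ^ 2 < g0 * l0) (hs1 : ∑ i, p i ^ 2 < 1)
    (C' : ℝ≥0∞) (hC'top : C' ≠ ⊤)
    (hC' : ∀ u > 0, ∀ v > 0,
      ∫⁻ z, (ρ.prod ρ) {w | w.1 0 ≠ w.2 0 ∧ |Fd d w (cl q z.1)| ≤ u ∧ |Fd d w (cl q z.2)| ≤ v}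
        ∂((volume.restrict (Icc g0 g1)).prod (volume.restrict (Icc l0 l1))) ≤
      C' * ENNReal.ofReal (u * v)) :
    ∀ᵐ z : ℝ × ℝ ∂volume, z ∈ Icc g0 g1 ×ˢ Icc l0 l1 →
      (ρ.map (PiTwo m d z.1 z.2)) ≪ (volume : Measure (ℝ × ℝ)) ∧
        ∫⁻ x, ((ρ.map (PiTwo m d z.1 z.2)).rnDeriv volume x) ^ 2 < ⊤ := by
  have := hρ.1
  rw [← ae_restrict_iff' (measurableSet_Icc.prod measurableSet_Icc), Measure.volume_eq_prod]
  have hint := K_integral d hp hρ hq0 hq1 hg0 hg1 hl0 hl1 hs hs1 C' hC'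
  rw [Measure.prod_restrict] at hint
  set Q := (volume.prod volume).restrict (Icc g0 g1 ×ˢ Icc l0 l1) with hQ
  set r : ℕ → ℝ := fun j => 1 / ((j : ℝ) + 1) with hrdef
  have hr : ∀ j, 0 < r j := fun j => Nat.one_div_pos_of_nat
  have hr0 : Tendsto r atTop (𝓝 0) := tendsto_one_div_add_atTop_nhds_zero_nat
  have hcF := continuous_Fd_cl d hq0 hq1
  have hmK : ∀ j, Measurable (fun z : ℝ × ℝ => (ρ.prod ρ) {w |
      |Fd d w (cl q z.1)| ≤ r j ∧ |Fd d w (cl q z.2)| ≤ r j} * (ENNReal.ofReal (4 * (r j * r j)))⁻¹) := by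
    intro j
    have hE : MeasurableSet {z : (ℝ × ℝ) × ((ℕ → Fin m) × (ℕ → Fin m)) |
        |Fd d z.2 (cl q z.1.1)| ≤ r j ∧ |Fd d z.2 (cl q z.1.2)| ≤ r j} := by
      refine IsClosed.measurableSet (IsClosed.inter ?_ ?_)
      · exact isClosed_le (hcF.comp (f := fun z : (ℝ × ℝ) × ((ℕ → Fin m) × (ℕ → Fin m)) =>
          (z.2, z.1.1)) (by fun_prop)).abs continuous_const
      · exact isClosed_le (hcF.comp (f := fun z : (ℝ × ℝ) × ((ℕ → Fin m) × (ℕ → Fin m)) =>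
          (z.2, z.1.2)) (by fun_prop)).abs continuous_const
    exact (measurable_measure_prodMk_left (ν := ρ.prod ρ) hE).mul_const _
  set c := C' * (1 - ENNReal.ofReal ((∑ i, p i ^ 2) / (g0 * l0)))⁻¹ with hc
  have hctop : c ≠ ⊤ := by
    refine ENNReal.mul_ne_top hC'top (ENNReal.inv_ne_top.2 ?_)
    have : (∑ i, p i ^ 2) / (g0 * l0) < 1 := (div_lt_one (by positivity)).2 hs
    exact (tsub_pos_of_lt (by simpa using this)).ne'
  have hF : ∫⁻ z, liminf (fun j => (ρ.prod ρ) {w |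
      |Fd d w (cl q z.1)| ≤ r j ∧ |Fd d w (cl q z.2)| ≤ r j} * (ENNReal.ofReal (4 * (r j * r j)))⁻¹) atTop ∂Q
      ≤ c := by
    refine (lintegral_liminf_le hmK).trans ?_
    refine liminf_le_of_frequently_le' (Frequently.of_forall fun j => ?_)
    have hrj : 0 < r j * r j := mul_pos (hr j) (hr j)
    rw [lintegral_mul_const' _ _ (ENNReal.inv_ne_top.2 (by simpa using hrj))]
    refine (mul_le_mul_left (hint (r j) (hr j)) _).trans ?_
    rw [mul_assoc]
    refine mul_le_of_le_one_right' ?_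
    rw [← div_eq_mul_inv]
    refine ENNReal.div_le_of_le_mul ?_
    rw [one_mul]
    exact ENNReal.ofReal_le_ofReal (by linarith)
  have hlt := ae_lt_top (Measurable.liminf hmK) (hF.trans_lt hctop.lt_top).ne
  filter_upwards [hlt, ae_restrict_mem (measurableSet_Icc.prod measurableSet_Icc)] with z hz hzm
  obtain ⟨⟨h1, h2⟩, ⟨h3, h4⟩⟩ := hzm
  have e1 := cl_eq (hg0.le.trans h1) (h2.trans hg1)
  have e2 := cl_eq (hl0.le.trans h3) (h4.trans hl1)
  have b1 := (h2.trans hg1).trans_lt hq1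
  have b2 := (h4.trans hl1).trans_lt hq1
  have hm : Measurable (PiTwo m d z.1 z.2) :=
    ((continuous_PiOne d (hg0.le.trans h1) b1).prodMk (continuous_PiOne d (hl0.le.trans h3) b2)).measurable
  have : IsProbabilityMeasure (ρ.map (PiTwo m d z.1 z.2)) :=
    Measure.isProbabilityMeasure_map hm.aemeasurable
  refine ac_criterion _ r hr hr0 ?_
  simp only [e1, e2] at hz
  convert hz using 3 with j
  exact energy_eq d ρ (hg0.le.trans h1) b1 (hl0.le.trans h3) b2 (hr j)

/-- Under (i) local integrability of `λ ↦ ‖dν_λ/dx‖₂²` on `I`, (ii) absence of double roots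
on `J`, and (iii) a transversality region `R`, for a.e. `(γ,λ)` in
`S = (R ∩ (I×I) ∩ Γ(s,1)) ∪ ((J×I) ∩ Γ(s,1))` the measure `μ_{γ,λ}` is absolutely
continuous with an `L²` density. -/
theorem absolutely_continuous_L2_general
    (m : ℕ) (hm : 2 ≤ m) (d : Fin m → ℝ) (hd0 : d ⟨0, by omega⟩ = 0) (hd : StrictMono d)
    (p : Fin m → ℝ) (hp0 : ∀ i, 0 ≤ p i) (hp1 : ∑ i, p i = 1)
    (ρ : Measure (ℕ → Fin m)) (hρ : IsBernoulliWith (fun i => ENNReal.ofReal (p i)) ρ)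
    (i1 i2 : ℝ) (hI : Ioo i1 i2 ⊆ Ioo (1 / (m : ℝ)) 1)
    (hInorm : ∀ a b : ℝ, Icc a b ⊆ Ioo i1 i2 →
      ∫⁻ l in Icc a b, densityL2sq (ρ.map (PiOne m d l)) < ⊤)
    (j1 j2 : ℝ) (hJ : Ioo j1 j2 ⊆ Ioo (1 / (m : ℝ)) 1)
    (hJroots : ∀ c : ℕ → ℝ, memB m d c → ∀ α ∈ Ioo j1 j2, ¬ HasDoubleRootAt c α)
    (R : Set (ℝ × ℝ)) (hR : IsOpen R)
    (hRroots : ∀ q ∈ R, ∀ c : ℕ → ℝ, memB m d c →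
      ¬ (HasDoubleRootAt c q.1 ∧ HasDoubleRootAt c q.2)) :
    ∀ᵐ q : ℝ × ℝ ∂volume,
      q ∈ (R ∩ (Ioo i1 i2 ×ˢ Ioo i1 i2) ∩ Gamma m (∑ i, p i ^ 2) 1) ∪
          ((Ioo j1 j2 ×ˢ Ioo i1 i2) ∩ Gamma m (∑ i, p i ^ 2) 1) →
        (ρ.map (PiTwo m d q.1 q.2)) ≪ (volume : Measure (ℝ × ℝ)) ∧
        ∫⁻ x, ((ρ.map (PiTwo m d q.1 q.2)).rnDeriv volume x) ^ 2 < ⊤ := by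
  set s := ∑ i, p i ^ 2 with hs
  have hprob := hρ.1
  rw [ae_iff]
  refine measure_null_of_locally_null _ fun q hq => ?_
  have hq := Classical.not_imp.1 hq
  have hqS := hq.1
  have hΓ : q ∈ Gamma m s 1 := by
    rcases hqS with h | h
    · exact h.2
    · exact h.2
  obtain ⟨hx0, hxy, hy1, -, hsq, -⟩ := hΓ
  have hy0 := hx0.trans hxy
  have hx1 := hxy.trans hy1
  have hyI : q.2 ∈ Ioo i1 i2 := by
    rcases hqS with h | h
    · exact h.1.2.2
    · exact h.1.2
  -- transversality
  have hnd : ∀ (w : (ℕ → Fin m) × (ℕ → Fin m)) (x : ℝ), 0 < x → x < 1 →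
      ¬ (Fd d w x ≠ 0 ∨ Fd' d w x ≠ 0) → HasDoubleRootAt (fun n => d (w.1 n) - d (w.2 n)) x := by
    intro w x h0 h1 h
    push Not at h
    exact ⟨(Fd_eq_Beval d w h0.le h1).symm.trans h.1, (hasDerivAt_Beval d w h0 h1).deriv.trans h.2⟩
  have hB : ∀ w : (ℕ → Fin m) × (ℕ → Fin m), w.1 0 ≠ w.2 0 →
      memB m d (fun n => d (w.1 n) - d (w.2 n)) := fun w hw =>
    ⟨fun n => ⟨_, _, rfl⟩, sub_ne_zero.2 fun h => hw (hd.injective h)⟩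
  obtain ⟨δ, hδ, η₀, hη₀, hTr⟩ := Tr_uniform d q.1 q.2 hx0 hx1 hy0 hy1 (q.1 ∈ Ioo i1 i2) (by
    intro w hw
    by_contra hcon
    rw [not_or] at hcon
    have h1 := hnd w q.1 hx0 hx1 hcon.1
    rcases hqS with h | h
    · have h2 := hnd w q.2 hy0 hy1 fun h' => hcon.2 ⟨h.1.2.1, h'⟩
      exact hRroots q h.1.1 _ (hB w hw) ⟨h1, h2⟩
    · exact hJroots _ (hB w hw) q.1 h.1.1 h1)
  -- choose a small rectangle
  have hsub : ∀ x : ℝ, Tendsto (fun η : ℝ => x - η) (𝓝[>] 0) (𝓝 x) := fun x => by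
    have : Tendsto (fun η : ℝ => x - η) (𝓝 0) (𝓝 (x - 0)) := (by fun_prop : Continuous fun η : ℝ => x - η).tendsto 0
    rw [sub_zero] at this
    exact this.mono_left nhdsWithin_le_nhds
  have hadd : ∀ x : ℝ, Tendsto (fun η : ℝ => x + η) (𝓝[>] 0) (𝓝 x) := fun x => by
    have : Tendsto (fun η : ℝ => x + η) (𝓝 0) (𝓝 (x + 0)) := (by fun_prop : Continuous fun η : ℝ => x + η).tendsto 0
    rw [add_zero] at this
    exact this.mono_left nhdsWithin_le_nhds
  have hκ : ∀ᶠ η in 𝓝[>] (0 : ℝ), q.1 ∈ Ioo i1 i2 → i1 < q.1 - η ∧ q.1 + η < i2 := by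
    by_cases h : q.1 ∈ Ioo i1 i2
    · filter_upwards [(hsub q.1).eventually (lt_mem_nhds h.1), (hadd q.1).eventually (gt_mem_nhds h.2)]
        with η a b _ using ⟨a, b⟩
    · exact Eventually.of_forall fun η h' => absurd h' h
  obtain ⟨η, hη, hηη, a1, a2, a3, a4, a5, a6, a7, a8⟩ := ((eventually_mem_nhdsWithin (a := (0:ℝ)) (s := Ioi 0)).and
    ((show ∀ᶠ η in 𝓝[>] (0 : ℝ), η < η₀ from (gt_mem_nhds hη₀).filter_mono nhdsWithin_le_nhds).and
    (((hsub q.1).eventually (lt_mem_nhds hx0)).and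
    (((hsub q.2).eventually (lt_mem_nhds hy0)).and
    (((hadd q.1).eventually (gt_mem_nhds hx1)).and
    (((hadd q.2).eventually (gt_mem_nhds hy1)).and
    (((hsub q.2).eventually (lt_mem_nhds hyI.1)).and
    (((hadd q.2).eventually (gt_mem_nhds hyI.2)).and
    ((((hsub q.1).mul (hsub q.2)).eventually (lt_mem_nhds hsq)).and hκ))))))))).exists
  have hη : 0 < η := hη
  have hs1 : s < 1 := hsq.trans (by nlinarith)
  obtain ⟨C', hC'top, hC'⟩ := N_bound d ρ (q := max (q.1 + η) (q.2 + η)) (g0 := q.1 - η) (g1 := q.1 + η)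
    (l0 := q.2 - η) (l1 := q.2 + η) (C := (2 * η + 2) / δ)
    (le_max_of_le_left (by linarith)) (max_lt a3 a4) a1.le (le_max_left _ _) a2.le (le_max_right _ _)
    (by positivity) (q.1 ∈ Ioo i1 i2) (by
      intro w hw
      have key : ∀ x₀ : ℝ, 0 < x₀ - η → x₀ + η < 1 → Tr d x₀ w δ η₀ → ∀ u > 0,
          volume {x | x ∈ Icc (x₀ - η) (x₀ + η) ∧ |Fd d w x| ≤ u} ≤
            ENNReal.ofReal ((2 * η + 2) / δ * u) := by
        intro x₀ h0 h1 h u hu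
        have := transversal_volume (Fd d w) (Fd' d w) (x₀ - η) (x₀ + η) δ u (by linarith) hδ hu
          (fun x hx => hasDerivAt_Fd d w (by linarith [hx.1]) (by linarith [hx.2]))
          (h.mono le_rfl hηη.le)
        have e : x₀ + η - (x₀ - η) + 2 = 2 * η + 2 := by ring
        rwa [e] at this
      exact (hTr w hw).imp (key q.1 a1 a3) (fun h => ⟨h.1, key q.2 a2 a4 h.2⟩))
    (hInorm _ _ fun x hx => ⟨a5.trans_le hx.1, hx.2.trans_lt a6⟩)
    (fun h => hInorm _ _ fun x hx => ⟨(a8 h).1.trans_le hx.1, hx.2.trans_lt (a8 h).2⟩)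
  have hfin := local_ae d hp0 hρ (le_max_of_le_left (by linarith)) (max_lt a3 a4) a1 (le_max_left _ _)
    a2 (le_max_right _ _) a7 hs1 C' hC'top hC'
  rw [ae_iff] at hfin
  refine ⟨_, ?_, hfin⟩
  rw [mem_nhdsWithin_iff_exists_mem_nhds_inter]
  refine ⟨Icc (q.1 - η) (q.1 + η) ×ˢ Icc (q.2 - η) (q.2 + η),
    prod_mem_nhds (Icc_mem_nhds (by linarith) (by linarith)) (Icc_mem_nhds (by linarith) (by linarith)), ?_⟩
  rintro z ⟨hz1, hz2⟩ hcon
  exact hz2 fun _ => hcon hz1
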